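/- arXiv:math/0010089 — 2 statements merged into one kernel-verified Lean document; each statement's English description precedes it below -/
import Mathlib

section
/- Let G and H be finite groups and f : G → H a group homomorphism such that the induced map on conjugacy classes (sending the conjugacy class of g to the conjugacy class of f(g)) is a bijection from the set of conjugacy classes of G to the set of conjugacy classes of H. Then f is an isomorphism of groups (i.e. f is bijective). -/
/-- **Jordan's lemma**: a subgroup of a finite group that meets every conjugacy class is the
whole group. -/
theorem Subgroup.eq_top_of_forall_exists_isConj {G : Type*} [Group G] [Finite G]
    (K : Subgroup G) (hK : ∀ g : G, ∃ k ∈ K, IsConj k g) : K = ⊤ := by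
  classical
  have := Fintype.ofFinite G
  have hfix (g : G) : 1 ≤ Fintype.card (MulAction.fixedBy (G ⧸ K) g) := by
    obtain ⟨k, hk, hkg⟩ := hK g
    obtain ⟨c, rfl⟩ := isConj_iff.mp hkg
    refine Fintype.card_pos_iff.mpr ⟨⟨(c : G ⧸ K), ?_⟩⟩
    rw [MulAction.mem_fixedBy, MulAction.Quotient.smul_coe, smul_eq_mul, eq_comm,
      QuotientGroup.eq]
    simpa [mul_assoc] using hk
  have hsum : ∑ g : G, Fintype.card (MulAction.fixedBy (G ⧸ K) g) = ∑ _g : G, 1 := by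
    have horbits : Fintype.card (Quotient (MulAction.orbitRel G (G ⧸ K))) = 1 :=
      Fintype.card_eq_one_iff_nonempty_unique.mpr
        ⟨⟨⟨Quotient.mk _ (1 : G)⟩, fun x ↦
          (MulAction.pretransitive_iff_subsingleton_quotient G (G ⧸ K)).mp inferInstance
            |>.elim _ _⟩⟩
    rw [MulAction.sum_card_fixedBy_eq_card_orbits_mul_card_group G (G ⧸ K), horbits]
    simp
  have hone := (Finset.sum_eq_sum_iff_of_le fun g _ ↦ hfix g).mp hsum.symm 1 (Finset.mem_univ _)
  rw [← Subgroup.index_eq_one, Subgroup.index, hone, ← Nat.card_eq_fintype_card,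
    MulAction.fixedBy_one_eq_univ, Nat.card_univ]

/-- A homomorphism of finite groups inducing a bijection on conjugacy classes is an
isomorphism. -/
theorem bijective_of_bijective_conjClasses_map {G H : Type*} [Group G] [Group H]
    [Finite G] [Finite H] (f : G →* H)
    (hf : Function.Bijective (ConjClasses.map f)) :
    Function.Bijective f := by
  constructor
  · refine (injective_iff_map_eq_one f).mpr fun g hg ↦ ?_
    have hmk : ConjClasses.mk g = ConjClasses.mk 1 :=
      hf.1 (congrArg ConjClasses.mk (hg.trans f.map_one.symm))
    exact isConj_one_left.mp (ConjClasses.mk_eq_mk_iff_isConj.mp hmk)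
  · refine MonoidHom.range_eq_top.mp (f.range.eq_top_of_forall_exists_isConj fun h ↦ ?_)
    obtain ⟨c, hc⟩ := hf.2 (ConjClasses.mk h)
    obtain ⟨g, rfl⟩ := ConjClasses.exists_rep c
    exact ⟨f g, ⟨g, rfl⟩, ConjClasses.mk_eq_mk_iff_isConj.mp hc⟩
end

section
/- Let k be an algebraically closed field and D a division ring equipped with a k-algebra structure such that the structure map k → D is not surjective. Then the dimension (rank) of D as a k-vector space is at least the cardinality of k. -/
universe u v

open Polynomial in
/-- If `x` is an element of a division algebra `D` over a field `k` which is transcendental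
over `k`, then the resolvents `(x - a)⁻¹`, `a : k`, are linearly independent over `k`.
This is `Transcendental.linearIndependent_sub_inv` without commutativity of `D`. -/
theorem Transcendental.linearIndependent_sub_inv_of_divisionRing
    {k D : Type*} [Field k] [DivisionRing D] [Algebra k D] {x : D} (H : Transcendental k x) :
    LinearIndependent k fun a ↦ (x - algebraMap k D a)⁻¹ := by
  classical
  rw [transcendental_iff] at H
  refine linearIndependent_iff'.2 fun s m hm i hi ↦ ?_
  have hnz (a : k) : x - algebraMap k D a ≠ 0 := by
    intro h
    refine X_sub_C_ne_zero a (H (X - C a) ?_)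
    rw [map_sub, aeval_X, aeval_C, h]
  have h1 (j : k) (hj : j ∈ s) :
      Polynomial.aeval x (C (m j) * (s.erase j).prod fun l ↦ (X - C l : k[X])) =
        Polynomial.aeval x (s.prod fun l ↦ (X - C l : k[X])) * (m j • (x - algebraMap k D j)⁻¹) := by
    rw [← s.prod_erase_mul _ hj, map_mul, map_mul, aeval_C, map_sub, aeval_X, aeval_C,
      mul_smul_comm, mul_inv_cancel_right₀ (hnz j), Algebra.smul_def]
  let p : k[X] := s.sum fun j ↦ C (m j) * (s.erase j).prod fun l ↦ X - C l
  have hp : p = 0 := H p <| by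
    rw [map_sum, Finset.sum_congr rfl h1, ← Finset.mul_sum, hm, mul_zero]
  have h2 (j : k) (hj : j ∈ s) (hji : j ≠ i) :
      eval i (C (m j) * (s.erase j).prod fun l ↦ (X - C l : k[X])) = 0 := by
    rw [← (s.erase j).prod_erase_mul _ (Finset.mem_erase_of_ne_of_mem hji.symm hi)]
    simp
  have h3 : eval i p = 0 := by rw [hp, eval_zero]
  rw [eval_finsetSum, Finset.sum_eq_single_of_mem i hi h2, eval_mul, eval_C, eval_prod] at h3
  refine (mul_eq_zero.1 h3).resolve_right (Finset.prod_ne_zero_iff.2 fun j hj ↦ ?_)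
  rw [eval_sub, eval_X, eval_C]
  exact sub_ne_zero.2 (Finset.ne_of_mem_erase hj).symm

/-- A division algebra over an algebraically closed field `k` which is strictly larger
than `k` has `k`-dimension at least the cardinality of `k`. -/
theorem rank_ge_card_of_not_surjective {k : Type u} {D : Type v} [Field k] [IsAlgClosed k]
    [DivisionRing D] [Algebra k D] (h : ¬ Function.Surjective (algebraMap k D)) :
    Cardinal.lift.{v} (Cardinal.mk k) ≤ Cardinal.lift.{u} (Module.rank k D) := by
  have hD : ¬ Algebra.IsAlgebraic k D := fun hD ↦
    have := Algebra.isAlgebraic_iff_isIntegral.1 hD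
    h IsAlgClosed.algebraMap_bijective_of_isIntegral.2
  rw [Algebra.isAlgebraic_def, not_forall] at hD
  obtain ⟨x, hx⟩ := hD
  have hx : Transcendental k x := hx
  exact hx.linearIndependent_sub_inv_of_divisionRing.cardinal_lift_le_rank
end
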